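/- arXiv:2008.06248 — 2 statements merged into one kernel-verified Lean document; each statement's English description precedes it below -/
import Mathlib

section
/- Let H, r, b, λ be positive integers with 0 < r, b < H, λ < min(r,b) and r + b ≤ H + λ. Index rows by the b-subsets B of [0,H) and columns by the r-subsets A of [0,H), and define the array P' by p'_{B,A} = ((A∪B)\(A∩B), A\B) if |A∩B| = λ, and p'_{B,A} = * otherwise. Then P' is a placement delivery array with K = C(H,r) columns, F = C(H,b) rows, exactly Z = C(H,b) − C(r,λ)·C(H−r, b−λ) stars in each column, and exactly S = C(H, r+b−2λ)·C(r+b−2λ, r−λ) distinct non-star labels, each occurring at least once; moreover any two distinct entries carrying the same label lie in distinct rows and distinct columns and the two cross entries are stars (property C3). -/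
theorem aux_c1 {H : ℕ} (A : Finset (Fin H)) (r b l : ℕ) (hA : A.card = r) (hlb : l < b) :
    ((Finset.powersetCard b (Finset.univ : Finset (Fin H))).filter
          fun B => (A ∩ B).card = l).card = Nat.choose r l * Nat.choose (H - r) (b - l) := by
  have h1 : Nat.choose r l * Nat.choose (H - r) (b - l)
      = (Finset.powersetCard l A ×ˢ Finset.powersetCard (b - l) Aᶜ).card := by
    rw [Finset.card_product, Finset.card_powersetCard, Finset.card_powersetCard,
      Finset.card_compl, hA, Fintype.card_fin]
  rw [h1]
  refine Finset.card_nbij' (fun B => (A ∩ B, B \ A)) (fun p => p.1 ∪ p.2) ?_ ?_ ?_ ?_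
  · intro B hB
    simp only [Finset.coe_filter, Finset.mem_powersetCard, Set.mem_ofPred_eq] at hB
    have h2 := Finset.card_sdiff_add_card_inter B A
    rw [Finset.inter_comm B A] at h2
    simp only [Finset.coe_product, Set.mem_prod, Finset.mem_coe, Finset.mem_powersetCard]
    refine ⟨⟨Finset.inter_subset_left, hB.2⟩, ?_, by omega⟩
    intro x hx
    simp at hx ⊢
    exact hx.2
  · rintro ⟨X, Y⟩ hp
    simp only [Finset.coe_product, Set.mem_prod, Finset.mem_coe, Finset.mem_powersetCard] at hp
    obtain ⟨⟨hX, hXc⟩, hY, hYc⟩ := hp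
    have hYA : ∀ x ∈ Y, x ∉ A := fun x hx => by simpa using hY hx
    simp only [Finset.coe_filter, Finset.mem_powersetCard, Set.mem_ofPred_eq]
    refine ⟨⟨Finset.subset_univ _, ?_⟩, ?_⟩
    · rw [Finset.card_union_of_disjoint]
      · omega
      · rw [Finset.disjoint_left]
        intro x hx hy
        exact hYA x hy (hX hx)
    · have : A ∩ (X ∪ Y) = X := by
        ext x
        have := hYA x
        have := @hX x
        simp only [Finset.mem_inter, Finset.mem_union]
        tauto
      rw [this, hXc]
  · intro B _
    ext x
    simp only [Finset.mem_inter, Finset.mem_union, Finset.mem_sdiff]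
    tauto
  · rintro ⟨X, Y⟩ hp
    simp only [Finset.coe_product, Set.mem_prod, Finset.mem_coe, Finset.mem_powersetCard] at hp
    obtain ⟨⟨hX, hXc⟩, hY, hYc⟩ := hp
    have hYA : ∀ x ∈ Y, x ∉ A := fun x hx => by simpa using hY hx
    ext x
    · have := hYA x
      have := @hX x
      simp only [Finset.mem_inter, Finset.mem_union]
      tauto
    · have := hYA x
      have := @hX x
      simp only [Finset.mem_sdiff, Finset.mem_union]
      tauto

theorem aux_c2 {H : ℕ} (m k : ℕ) (T : Finset (Finset (Fin H) × Finset (Fin H)))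
    (hT : ∀ C D, (C, D) ∈ T ↔ C.card = m ∧ D ⊆ C ∧ D.card = k) :
    T.card = Nat.choose H m * Nat.choose m k := by
  have h1 : T.card = ((Finset.powersetCard m (Finset.univ : Finset (Fin H))).sigma
      (fun C => Finset.powersetCard k C)).card := by
    refine Finset.card_nbij' (fun p => ⟨p.1, p.2⟩) (fun p => (p.1, p.2)) ?_ ?_ ?_ ?_
    · rintro ⟨C, D⟩ h
      simpa [Finset.mem_powersetCard] using (hT C D).1 h
    · rintro ⟨C, D⟩ h
      exact (hT C D).2 (by simpa [Finset.mem_powersetCard] using h)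
    · rintro ⟨C, D⟩ _; rfl
    · rintro ⟨C, D⟩ _; rfl
  rw [h1, Finset.card_sigma, Finset.sum_congr rfl (g := fun _ => Nat.choose m k)]
  · simp
  · intro C hC
    rw [Finset.card_powersetCard, (Finset.mem_powersetCard.1 hC).2]

/-- Equal labels force the cross intersection to be contained in both diagonal ones. -/
theorem aux_c3 {H : ℕ} (l : ℕ) (B₁ A₁ B₂ A₂ : Finset (Fin H))
    (h1 : (A₁ ∩ B₁).card = l) (h2 : (A₂ ∩ B₂).card = l)
    (hC : (A₁ ∪ B₁) \ (A₁ ∩ B₁) = (A₂ ∪ B₂) \ (A₂ ∩ B₂)) (hD : A₁ \ B₁ = A₂ \ B₂)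
    (h : (A₁ ∩ B₂).card = l) : B₁ = B₂ ∧ A₁ = A₂ := by
  have s1 : A₁ ∩ B₂ ⊆ A₁ ∩ B₁ := by
    intro x
    have e1 := Finset.ext_iff.1 hC x
    have e2 := Finset.ext_iff.1 hD x
    simp only [Finset.mem_inter, Finset.mem_union, Finset.mem_sdiff] at *
    tauto
  have s2 : A₁ ∩ B₂ ⊆ A₂ ∩ B₂ := by
    intro x
    have e1 := Finset.ext_iff.1 hC x
    have e2 := Finset.ext_iff.1 hD x
    simp only [Finset.mem_inter, Finset.mem_union, Finset.mem_sdiff] at *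
    tauto
  have t1 := Finset.eq_of_subset_of_card_le s1 (by omega)
  have t2 := Finset.eq_of_subset_of_card_le s2 (by omega)
  have t : A₁ ∩ B₁ = A₂ ∩ B₂ := t1.symm.trans t2
  constructor <;>
  · ext x
    have e1 := Finset.ext_iff.1 hC x
    have e2 := Finset.ext_iff.1 hD x
    have e3 := Finset.ext_iff.1 t x
    simp only [Finset.mem_inter, Finset.mem_union, Finset.mem_sdiff] at e1 e2 e3
    clear s1 s2 t1 t2 t hC hD h h1 h2
    by_cases a1 : x ∈ A₁ <;> by_cases a2 : x ∈ A₂ <;> by_cases b1 : x ∈ B₁ <;>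
      by_cases b2 : x ∈ B₂ <;> simp_all

/-- The array `P'` indexed by rows `B` (the `b`-subsets of `[0,H)`) and columns
`A` (the `r`-subsets of `[0,H)`), with `p'_{B,A} = ((A∪B)\(A∩B), A\B)` if `|A∩B| = λ` and
`p'_{B,A} = *` otherwise, is a placement delivery array: (C1) each column has exactly
`C(H,b) − C(r,λ)·C(H−r,b−λ)` stars; (C2) there are exactly
`C(H, r+b−2λ)·C(r+b−2λ, r−λ)` distinct non-star labels (each occurring at least once,
being elements of the image); (C3) two distinct entries with the same label lie in distinct
rows and distinct columns, and both cross entries are stars. -/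
theorem stmt_4 (H r b l : ℕ) (hH : 0 < H) (hr : 0 < r) (hb : 0 < b) (hl : 0 < l)
    (hrH : r < H) (hbH : b < H) (hlr : l < r) (hlb : l < b) (hrb : r + b ≤ H + l) :
    -- C1: exactly Z stars in each column
    (∀ A ∈ Finset.powersetCard r (Finset.univ : Finset (Fin H)),
      ((Finset.powersetCard b (Finset.univ : Finset (Fin H))).filter
          fun B => (A ∩ B).card ≠ l).card
        = Nat.choose H b - Nat.choose r l * Nat.choose (H - r) (b - l)) ∧
    -- C2: exactly S distinct non-star labels, each occurring at least once
    ((((Finset.powersetCard b (Finset.univ : Finset (Fin H))) ×ˢ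
        (Finset.powersetCard r (Finset.univ : Finset (Fin H)))).filter
          (fun p => (p.2 ∩ p.1).card = l)).image
          (fun p => ((p.2 ∪ p.1) \ (p.2 ∩ p.1), p.2 \ p.1))).card
      = Nat.choose H (r + b - 2 * l) * Nat.choose (r + b - 2 * l) (r - l) ∧
    -- C3
    (∀ B₁ A₁ B₂ A₂ : Finset (Fin H),
      B₁.card = b → A₁.card = r → B₂.card = b → A₂.card = r →
      (A₁ ∩ B₁).card = l → (A₂ ∩ B₂).card = l → (B₁, A₁) ≠ (B₂, A₂) →
      ((A₁ ∪ B₁) \ (A₁ ∩ B₁), A₁ \ B₁) = ((A₂ ∪ B₂) \ (A₂ ∩ B₂), A₂ \ B₂) →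
      B₁ ≠ B₂ ∧ A₁ ≠ A₂ ∧ (A₁ ∩ B₂).card ≠ l ∧ (A₂ ∩ B₁).card ≠ l) := by
  refine ⟨?_, ?_, ?_⟩
  · intro A hA
    have h1 := aux_c1 A r b l (Finset.mem_powersetCard.1 hA).2 hlb
    have h2 := Finset.card_filter_add_card_filter_not
      (s := Finset.powersetCard b (Finset.univ : Finset (Fin H))) (fun B => (A ∩ B).card = l)
    rw [Finset.card_powersetCard, Finset.card_univ, Fintype.card_fin, h1] at h2
    simp only [ne_eq]
    omega
  · apply aux_c2
    intro C D
    simp only [Finset.mem_image, Finset.mem_filter, Finset.mem_product, Finset.mem_powersetCard,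
      Prod.exists, Prod.mk.injEq]
    constructor
    · rintro ⟨B, A, ⟨⟨⟨_, hB⟩, _, hA⟩, hI⟩, rfl, rfl⟩
      refine ⟨?_, ?_, ?_⟩
      · have e1 := Finset.card_sdiff_add_card_eq_card
          (Finset.inter_subset_left.trans Finset.subset_union_left : A ∩ B ⊆ A ∪ B)
        have e2 := Finset.card_union_add_card_inter A B
        omega
      · intro x
        simp only [Finset.mem_inter, Finset.mem_union, Finset.mem_sdiff]
        tauto
      · have e1 := Finset.card_sdiff_add_card_inter A B
        omega
    · rintro ⟨hC, hDC, hD⟩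
      have hcc : l ≤ (Cᶜ).card := by
        rw [Finset.card_compl, Fintype.card_fin]; omega
      obtain ⟨X, hX, hXc⟩ := Finset.exists_subset_card_eq hcc
      have hXC : ∀ x ∈ X, x ∉ C := fun x hx => by simpa using hX hx
      have e := Finset.card_sdiff_add_card_eq_card hDC
      have hI : (D ∪ X) ∩ ((C \ D) ∪ X) = X := by
        ext x
        simp only [Finset.mem_inter, Finset.mem_union, Finset.mem_sdiff]
        tauto
      refine ⟨(C \ D) ∪ X, D ∪ X, ⟨⟨⟨Finset.subset_univ _, ?_⟩, Finset.subset_univ _, ?_⟩, ?_⟩,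
        ?_, ?_⟩
      · rw [Finset.card_union_of_disjoint]
        · omega
        · rw [Finset.disjoint_left]
          intro x hx hy
          exact hXC x hy (Finset.mem_sdiff.1 hx).1
      · rw [Finset.card_union_of_disjoint]
        · omega
        · rw [Finset.disjoint_left]
          intro x hx hy
          exact hXC x hy (hDC hx)
      · rw [hI, hXc]
      · rw [hI]
        ext x
        have := hXC x
        have := @hDC x
        simp only [Finset.mem_union, Finset.mem_sdiff]
        tauto
      · ext x
        have := hXC x
        have := @hDC x
        simp only [Finset.mem_union, Finset.mem_sdiff]
        tauto
  · intro B₁ A₁ B₂ A₂ _ _ _ _ h1 h2 hne heq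
    obtain ⟨hC, hD⟩ := Prod.mk.inj heq
    have key : ¬ (B₁ = B₂ ∧ A₁ = A₂) := fun h => hne (by rw [h.1, h.2])
    have c1 : (A₁ ∩ B₂).card ≠ l := fun h => key (aux_c3 l B₁ A₁ B₂ A₂ h1 h2 hC hD h)
    have c2 : (A₂ ∩ B₁).card ≠ l := fun h => by
      have := aux_c3 l B₂ A₂ B₁ A₁ h2 h1 hC.symm hD.symm h
      exact key ⟨this.1.symm, this.2.symm⟩
    refine ⟨?_, ?_, c1, c2⟩
    · rintro rfl
      exact c1 h1
    · rintro rfl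
      exact c1 h2
end

section
/- Let H, r, b, λ be positive integers with 0 < r, b < H, λ < min(r,b) and r + b ≤ H + λ. In the array P', for every fixed column A (an r-subset of [0,H)), the number of rows B (b-subsets of [0,H)) such that p'_{B,A} = * is a useless star equals Σ_{i=λ+1}^{r} C(r,i)·C(H−r, b−i); equivalently, the useless stars in column A are exactly the entries p'_{B,A} with |A∩B| > λ. -/
/-- A star entry `p'_{B,A} = *` of the array `P'` (with labels `((A∪B)\(A∩B), A\B)` at
entries with `|A∩B| = λ`) is *useful* if there exist entries `p'_{B',A}` and `p'_{B,A'}`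
(with `B' ≠ B`, `A' ≠ A`) carrying the same non-star label. -/
def UsefulStarP' (H r b l : ℕ) (B A : Finset (Fin H)) : Prop :=
  ∃ A' B' : Finset (Fin H), A' ≠ A ∧ B' ≠ B ∧ A'.card = r ∧ B'.card = b ∧
    (A ∩ B').card = l ∧ (A' ∩ B).card = l ∧
    ((A ∪ B') \ (A ∩ B'), A \ B') = ((A' ∪ B) \ (A' ∩ B), A' \ B)

theorem useful_iff_aux (H r b l : ℕ) (hlr : l < r) (hlb : l < b)
    (A B : Finset (Fin H)) (hA : A.card = r) (hB : B.card = b) :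
    ((A ∩ B).card ≠ l ∧ ¬ UsefulStarP' H r b l B A) ↔ l < (A ∩ B).card := by
  have h1 := Finset.card_sdiff_add_card_inter A B
  have h2 := Finset.card_sdiff_add_card_inter B A
  rw [Finset.inter_comm B A] at h2
  constructor
  · rintro ⟨hne, hu⟩
    by_contra hlt
    apply hu
    have hi : (A ∩ B).card < l := by omega
    obtain ⟨E, hE, hEc⟩ := Finset.exists_subset_card_eq (s := A \ B) (n := r - l) (by omega)
    obtain ⟨F, hF, hFc⟩ := Finset.exists_subset_card_eq (s := B \ A) (n := b - l) (by omega)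
    have hE' : ∀ x ∈ E, x ∈ A ∧ x ∉ B := fun x hx => by simpa using hE hx
    have hF' : ∀ x ∈ F, x ∈ B ∧ x ∉ A := fun x hx => by simpa using hF hx
    have cE : (A \ E).card = l := by
      rw [Finset.card_sdiff_of_subset (fun x hx => (hE' x hx).1)]; omega
    have cF : (B \ F).card = l := by
      rw [Finset.card_sdiff_of_subset (fun x hx => (hF' x hx).1)]; omega
    have i1 : A ∩ ((A \ E) ∪ F) = A \ E := by
      ext x; have := hE' x; have := hF' x
      simp only [Finset.mem_inter, Finset.mem_union, Finset.mem_sdiff]; tauto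
    have i2 : ((B \ F) ∪ E) ∩ B = B \ F := by
      ext x; have := hE' x; have := hF' x
      simp only [Finset.mem_inter, Finset.mem_union, Finset.mem_sdiff]; tauto
    refine ⟨(B \ F) ∪ E, (A \ E) ∪ F, ?_, ?_, ?_, ?_, ?_, ?_, ?_⟩
    · intro h
      rw [h] at i2
      rw [i2] at hne; exact hne cF
    · intro h
      rw [h] at i1
      rw [i1] at hne; exact hne cE
    · rw [Finset.card_union_of_disjoint, cF, hEc]
      · omega
      · rw [Finset.disjoint_left]; intro x hx hx'
        exact (hE' x hx').2 (Finset.mem_sdiff.1 hx).1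
    · rw [Finset.card_union_of_disjoint, cE, hFc]
      · omega
      · rw [Finset.disjoint_left]; intro x hx hx'
        exact (hF' x hx').2 (Finset.mem_sdiff.1 hx).1
    · rw [i1, cE]
    · rw [i2, cF]
    · rw [Prod.mk.injEq]
      constructor <;>
      · ext x; have := hE' x; have := hF' x
        simp only [Finset.mem_inter, Finset.mem_union, Finset.mem_sdiff]; tauto
  · intro hlt
    refine ⟨by omega, ?_⟩
    rintro ⟨A', B', -, -, hA', hB', hc1, hc2, heq⟩
    have he := (Prod.mk.injEq _ _ _ _ ▸ heq).2
    have hsub : A \ B' ⊆ A \ B := by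
      intro x hx
      have hx2 := hx
      rw [he] at hx2
      rw [Finset.mem_sdiff] at *
      exact ⟨hx.1, hx2.2⟩
    have h3 := Finset.card_le_card hsub
    have h4 := Finset.card_sdiff_add_card_inter A B'
    omega

theorem card_fiber_aux (H r b i : ℕ) (hib : i ≤ b) (A : Finset (Fin H)) (hA : A.card = r) :
    (Finset.univ.filter (fun B : Finset (Fin H) => B.card = b ∧ (A ∩ B).card = i)).card
      = Nat.choose r i * Nat.choose (H - r) (b - i) := by
  have : Nat.choose r i * Nat.choose (H - r) (b - i)
      = (Finset.powersetCard i A ×ˢ Finset.powersetCard (b - i) Aᶜ).card := by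
    rw [Finset.card_product, Finset.card_powersetCard, Finset.card_powersetCard,
      Finset.card_compl, hA, Fintype.card_fin]
  rw [this]
  refine Finset.card_bij' (fun B _ => (A ∩ B, B \ A)) (fun p _ => p.1 ∪ p.2) ?_ ?_ ?_ ?_
  · intro B hB
    simp only [Finset.mem_filter, Finset.mem_univ, true_and] at hB
    have h2 := Finset.card_sdiff_add_card_inter B A
    rw [Finset.inter_comm B A] at h2
    simp only [Finset.mem_product, Finset.mem_powersetCard]
    refine ⟨⟨Finset.inter_subset_left, hB.2⟩, ?_, by omega⟩
    intro x hx
    simp only [Finset.mem_sdiff, Finset.mem_compl] at *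
    exact hx.2
  · rintro ⟨P, Q⟩ h
    simp only [Finset.mem_product, Finset.mem_powersetCard] at h
    obtain ⟨⟨hP, hPc⟩, hQ, hQc⟩ := h
    have hQ' : ∀ x ∈ Q, x ∉ A := fun x hx => by simpa using hQ hx
    simp only [Finset.mem_filter, Finset.mem_univ, true_and]
    constructor
    · rw [Finset.card_union_of_disjoint]
      · omega
      · rw [Finset.disjoint_left]; intro x hx hx'
        exact hQ' x hx' (hP hx)
    · have : A ∩ (P ∪ Q) = P := by
        ext x; have := hQ' x; have := @hP x
        simp only [Finset.mem_inter, Finset.mem_union]; tauto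
      rw [this, hPc]
  · intro B _
    ext x
    simp only [Finset.mem_inter, Finset.mem_union, Finset.mem_sdiff]; tauto
  · rintro ⟨P, Q⟩ h
    simp only [Finset.mem_product, Finset.mem_powersetCard] at h
    obtain ⟨⟨hP, hPc⟩, hQ, hQc⟩ := h
    have hQ' : ∀ x ∈ Q, x ∉ A := fun x hx => by simpa using hQ hx
    rw [Prod.mk.injEq]
    constructor <;>
    · ext x; have := hQ' x; have := @hP x
      simp only [Finset.mem_inter, Finset.mem_union, Finset.mem_sdiff]; tauto

/-- In the array `P'`, for every fixed column `A` (an `r`-subset of `[0,H)`),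
the number of rows `B` (`b`-subsets of `[0,H)`) such that `p'_{B,A} = *` is a useless star
equals `Σ_{i=λ+1}^{r} C(r,i)·C(H−r, b−i)` (with the usual convention that a term vanishes
when `b − i` would be negative, i.e. `i > b`); equivalently, the useless stars in column `A`
are exactly the entries `p'_{B,A}` with `|A∩B| > λ`. -/
theorem stmt_16 (H r b l : ℕ) (hH : 0 < H) (hr : 0 < r) (hb : 0 < b) (hl : 0 < l)
    (hrH : r < H) (hbH : b < H) (hlr : l < r) (hlb : l < b) (hrb : r + b ≤ H + l)
    (A : Finset (Fin H)) (hA : A.card = r) :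
    {B : Finset (Fin H) | B.card = b ∧ (A ∩ B).card ≠ l ∧ ¬ UsefulStarP' H r b l B A}.ncard
      = ∑ i ∈ Finset.Icc (l + 1) r,
          (if i ≤ b then Nat.choose r i * Nat.choose (H - r) (b - i) else 0) ∧
    ∀ B : Finset (Fin H), B.card = b →
      (((A ∩ B).card ≠ l ∧ ¬ UsefulStarP' H r b l B A) ↔ l < (A ∩ B).card) := by
  have key : ∀ B : Finset (Fin H), B.card = b →
      (((A ∩ B).card ≠ l ∧ ¬ UsefulStarP' H r b l B A) ↔ l < (A ∩ B).card) :=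
    fun B hB => useful_iff_aux H r b l hlr hlb A B hA hB
  refine ⟨?_, key⟩
  have hset : {B : Finset (Fin H) | B.card = b ∧ (A ∩ B).card ≠ l ∧ ¬ UsefulStarP' H r b l B A}
      = ((Finset.univ.filter (fun B : Finset (Fin H) => B.card = b ∧ l < (A ∩ B).card) :
          Finset (Finset (Fin H))) : Set (Finset (Fin H))) := by
    ext B
    simp only [Set.mem_setOf_eq, Finset.coe_filter, Finset.mem_univ, true_and]
    exact and_congr_right (fun hB => key B hB)
  rw [hset, Set.ncard_coe_finset,
    Finset.card_eq_sum_card_fiberwise (f := fun B => (A ∩ B).card) (t := Finset.Icc (l + 1) r)]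
  · refine Finset.sum_congr rfl fun i hi => ?_
    rw [Finset.mem_Icc] at hi
    rw [Finset.filter_filter]
    split_ifs with hib
    · rw [← card_fiber_aux H r b i hib A hA]
      congr 1
      ext B
      simp only [Finset.mem_filter, Finset.mem_univ, true_and]
      omega
    · rw [Finset.card_eq_zero, Finset.filter_eq_empty_iff]
      rintro B - ⟨⟨h1, h2⟩, h3⟩
      have := Finset.card_le_card (Finset.inter_subset_right : A ∩ B ⊆ B)
      omega
  · intro B hB
    simp only [Finset.coe_filter, Finset.mem_univ, true_and, Set.mem_setOf_eq] at hB
    have := Finset.card_le_card (Finset.inter_subset_left : A ∩ B ⊆ A)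
    simp only [Finset.coe_Icc, Set.mem_Icc]
    omega
end
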